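/- arXiv:2307.08377 — 3 statements merged into one kernel-verified Lean document; each statement's English description precedes it below -/
import Mathlib

section
/- Let A ∈ ℝ^{d×d} be a symmetric positive semidefinite matrix and let b ∈ range(A). Then the unique element ζ ∈ range(A) with A ζ = b is also the unique minimizer of the map ζ' ↦ ‖A ζ' − b‖₂ over the full Krylov space K_d(A,b) = span{b, A b, …, A^{d−1} b}. In other words, the partial-least-squares solution PLS(A,b) coincides with the least-squares solution LS(A,b). -/
/-- The Euclidean norm `‖v‖₂ = √(∑ i, v i ^ 2)` on `ℝ^d`. -/
noncomputable def euclNorm {d : ℕ} (v : Fin d → ℝ) : ℝ :=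
  Real.sqrt (∑ i, v i ^ 2)

/-- The Krylov space `K_s(A,b) := span{b, A b, …, A^{s−1} b} ⊆ ℝ^d`. -/
def krylov {d : ℕ} (A : Matrix (Fin d) (Fin d) ℝ) (b : Fin d → ℝ) (s : ℕ) :
    Submodule ℝ (Fin d → ℝ) :=
  Submodule.span ℝ ((fun k => (A ^ k).mulVec b) '' Set.Iio s)

theorem pow_mem_krylov {d : ℕ} (A : Matrix (Fin d) (Fin d) ℝ) (b : Fin d → ℝ) (k : ℕ) :
    (A ^ k).mulVec b ∈ krylov A b d := by
  rcases Nat.eq_zero_or_pos d with h0 | hd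
  · subst h0
    rw [Subsingleton.elim ((A ^ k).mulVec b) 0]
    exact Submodule.zero_mem _
  · have hdeg : (Polynomial.X ^ k %ₘ A.charpoly).natDegree < d := by
      have h1 : A.charpoly.natDegree = d := by
        rw [Matrix.charpoly_natDegree_eq_dim, Fintype.card_fin]
      have h2 := Polynomial.natDegree_modByMonic_lt (Polynomial.X ^ k) A.charpoly_monic
        (by intro h; rw [h, Polynomial.natDegree_one] at h1; omega)
      omega
    rw [Matrix.pow_eq_aeval_mod_charpoly, Polynomial.aeval_eq_sum_range' hdeg,
      Matrix.sum_mulVec]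
    refine Submodule.sum_mem _ fun i hi => ?_
    rw [Matrix.smul_mulVec]
    exact Submodule.smul_mem _ _ (Submodule.subset_span ⟨i, Finset.mem_range.1 hi, rfl⟩)

theorem inj_on_range {d : ℕ} (A : Matrix (Fin d) (Fin d) ℝ) (hA : A.PosSemidef)
    (x : Fin d → ℝ) (hx : x ∈ LinearMap.range A.mulVecLin) (h : A.mulVec x = 0) : x = 0 := by
  obtain ⟨y, rfl⟩ := hx
  rw [Matrix.mulVecLin_apply] at *
  have hT : A.transpose = A := by
    have := hA.isHermitian.eq
    rwa [Matrix.conjTranspose_eq_transpose_of_trivial] at this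
  rw [← dotProduct_self_eq_zero, Matrix.dotProduct_mulVec, ← Matrix.mulVec_transpose, hT, h,
    zero_dotProduct]

theorem krylov_le_range {d : ℕ} (A : Matrix (Fin d) (Fin d) ℝ) (b : Fin d → ℝ)
    (hb : b ∈ Set.range A.mulVec) (s : ℕ) : krylov A b s ≤ LinearMap.range A.mulVecLin := by
  refine Submodule.span_le.2 ?_
  rintro _ ⟨k, -, rfl⟩
  obtain ⟨y, rfl⟩ := hb
  refine ⟨(A ^ k).mulVec y, ?_⟩
  simp only [Matrix.mulVecLin_apply, Matrix.mulVec_mulVec]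
  rw [← pow_succ, ← pow_succ']

theorem krylov_invariant {d : ℕ} (A : Matrix (Fin d) (Fin d) ℝ) (b : Fin d → ℝ) :
    ∀ x ∈ krylov A b d, A.mulVecLin x ∈ krylov A b d := by
  intro x hx
  have : krylov A b d ≤ (krylov A b d).comap A.mulVecLin := by
    refine Submodule.span_le.2 ?_
    rintro _ ⟨k, -, rfl⟩
    have := pow_mem_krylov A b (k + 1)
    rw [pow_succ', ← Matrix.mulVec_mulVec] at this
    exact this
  exact this hx

/-- Let `A` be symmetric positive semidefinite and `b ∈ range(A)`. The unique element
`ζ ∈ range(A)` with `A ζ = b` is also the unique minimizer of `ζ' ↦ ‖A ζ' − b‖₂` over the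
full Krylov space `K_d(A,b)`: the PLS solution coincides with the least-squares solution. -/
theorem pls_eq_ls {d : ℕ} (A : Matrix (Fin d) (Fin d) ℝ)
    (hA : A.PosSemidef) (b : Fin d → ℝ) (hb : b ∈ Set.range A.mulVec)
    (ζ : Fin d → ℝ) (hζ : ζ ∈ Set.range A.mulVec) (hAζ : A.mulVec ζ = b) :
    (ζ ∈ krylov A b d ∧
      ∀ ζ' ∈ krylov A b d, euclNorm (A.mulVec ζ - b) ≤ euclNorm (A.mulVec ζ' - b)) ∧
    (∀ ζ' ∈ krylov A b d,
      (∀ ζ'' ∈ krylov A b d, euclNorm (A.mulVec ζ' - b) ≤ euclNorm (A.mulVec ζ'' - b)) →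
        ζ' = ζ) := by
  have hinj : ∀ x ∈ LinearMap.range A.mulVecLin, ∀ y ∈ LinearMap.range A.mulVecLin,
      A.mulVec x = A.mulVec y → x = y := by
    intro x hx y hy h
    exact sub_eq_zero.1 (inj_on_range A hA _ (Submodule.sub_mem _ hx hy)
      (by rw [Matrix.mulVec_sub, h, sub_self]))
  have hK := krylov_le_range A b hb d
  have hζR : ζ ∈ LinearMap.range A.mulVecLin := hζ
  have hmem : ζ ∈ krylov A b d := by
    have hi : Function.Injective (A.mulVecLin.restrict (krylov_invariant A b)) := by
      intro x y hxy
      exact Subtype.ext (hinj _ (hK x.2) _ (hK y.2) (congrArg Subtype.val hxy))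
    have hbK : b ∈ krylov A b d := by simpa using pow_mem_krylov A b 0
    obtain ⟨z, hz⟩ := LinearMap.surjective_of_injective hi ⟨b, hbK⟩
    have hz' : A.mulVec z = b := congrArg Subtype.val hz
    rw [hinj ζ hζR z (hK z.2) (hAζ.trans hz'.symm)]
    exact z.2
  have h0 : euclNorm (A.mulVec ζ - b) = 0 := by simp [hAζ, euclNorm]
  refine ⟨⟨hmem, fun ζ' _ => h0 ▸ Real.sqrt_nonneg _⟩, fun ζ' h' hmin => ?_⟩
  have h1 := hmin ζ hmem
  rw [h0] at h1
  refine hinj _ (hK h') _ hζR ?_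
  rw [hAζ, ← sub_eq_zero]
  have h2 := Real.sqrt_eq_zero'.1 (le_antisymm h1 (Real.sqrt_nonneg _))
  have h3 := (Finset.sum_eq_zero_iff_of_nonneg (fun i _ => sq_nonneg _)).1
    (le_antisymm h2 (Finset.sum_nonneg fun i _ => sq_nonneg ((A.mulVec ζ' - b) i)))
  funext i
  exact pow_eq_zero_iff two_ne_zero |>.1 (h3 i (Finset.mem_univ i))
end

section
/- Let 1 ≤ m ≤ d be integers, P ∈ ℝ^{d×m} a matrix with PᵀP = I_m, A ∈ ℝ^{m×m} a symmetric positive definite matrix and b ∈ ℝ^m. Set Ã := P A Pᵀ ∈ ℝ^{d×d} and b̃ := P b ∈ ℝ^d. Then K_d(Ã, b̃) equals the image of K_m(A, b) under the linear map v ↦ P v, i.e. span{b̃, Ã b̃, …, Ã^{d−1} b̃} = P · span{b, A b, …, A^{m−1} b}. -/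
open Matrix

theorem krylov_pow_mem {m : ℕ} (hm : 1 ≤ m) (A : Matrix (Fin m) (Fin m) ℝ) (b : Fin m → ℝ)
    (k : ℕ) : (A ^ k).mulVec b ∈ krylov A b m := by
  have hlt : ((Polynomial.X : Polynomial ℝ) ^ k %ₘ A.charpoly).natDegree < m := by
    have h1 : A.charpoly.natDegree = m := by simp
    have := Polynomial.natDegree_modByMonic_lt ((Polynomial.X : Polynomial ℝ) ^ k)
      A.charpoly_monic (by intro h; rw [h] at h1; simp at h1; omega)
    omega
  rw [Matrix.pow_eq_aeval_mod_charpoly, Polynomial.aeval_eq_sum_range' hlt, Matrix.sum_mulVec]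
  refine Submodule.sum_mem _ fun i hi => ?_
  rw [Matrix.smul_mulVec]
  exact Submodule.smul_mem _ _ (Submodule.subset_span ⟨i, by simpa using hi, rfl⟩)

/-- Let `1 ≤ m ≤ d`, `P ∈ ℝ^{d×m}` with `PᵀP = I_m`, `A ∈ ℝ^{m×m}` symmetric positive
definite and `b ∈ ℝ^m`. With `Ã := P A Pᵀ` and `b̃ := P b`, the Krylov space `K_d(Ã, b̃)`
is the image of `K_m(A, b)` under the linear map `v ↦ P v`. -/
theorem krylov_conjugate {d m : ℕ} (hm : 1 ≤ m) (hmd : m ≤ d)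
    (P : Matrix (Fin d) (Fin m) ℝ) (hP : Pᵀ * P = 1)
    (A : Matrix (Fin m) (Fin m) ℝ) (hA : A.PosDef) (b : Fin m → ℝ) :
    krylov (P * A * Pᵀ) (P.mulVec b) d = Submodule.map P.mulVecLin (krylov A b m) := by
  have key : ∀ k : ℕ, ((P * A * Pᵀ) ^ k).mulVec (P.mulVec b) = P.mulVec ((A ^ k).mulVec b) := by
    intro k
    induction k with
    | zero => simp
    | succ k ih =>
      rw [pow_succ', ← Matrix.mulVec_mulVec, ih, pow_succ', Matrix.mulVec_mulVec,
        Matrix.mulVec_mulVec, Matrix.mulVec_mulVec]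
      congr 1
      calc P * A * Pᵀ * P * A ^ k = P * A * (Pᵀ * P) * A ^ k := by
            simp only [Matrix.mul_assoc]
        _ = P * (A * A ^ k) := by rw [hP, Matrix.mul_one, Matrix.mul_assoc]
  apply le_antisymm
  · refine Submodule.span_le.2 ?_
    rintro _ ⟨k, -, rfl⟩
    exact ⟨_, krylov_pow_mem hm A b k, (key k).symm⟩
  · refine Submodule.map_le_iff_le_comap.2 (Submodule.span_le.2 ?_)
    rintro _ ⟨k, hk, rfl⟩
    exact Submodule.subset_span ⟨k, lt_of_lt_of_le hk hmd, key k⟩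
end

section
/- Let A ∈ ℝ^{d×d} be a symmetric positive semidefinite matrix, b ∈ range(A), and let Ψ ∈ ℝ^{d×d} be any matrix such that A Ψ = Ψ A = 0 and Ψ b = 0. Let m := dim span{A^k b : k ∈ ℕ}. Then for every integer 1 ≤ s ≤ d, a vector ζ minimizes ζ' ↦ ‖(A + Ψ) ζ' − b‖₂ over K_s(A + Ψ, b) if and only if ζ minimizes ζ' ↦ ‖A ζ' − b‖₂ over K_{min(s,m)}(A, b). In particular the PLS solution with parameter s is invariant under such orthogonal shifts of the matrix. -/
/-- The full Krylov subspace `span{A^k b : k ∈ ℕ}`. -/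
def fullKrylov {d : ℕ} (A : Matrix (Fin d) (Fin d) ℝ) (b : Fin d → ℝ) :
    Submodule ℝ (Fin d → ℝ) :=
  Submodule.span ℝ (Set.range fun k : ℕ => (A ^ k).mulVec b)

theorem krylov_mono' {d : ℕ} (A : Matrix (Fin d) (Fin d) ℝ) (b : Fin d → ℝ) {s t : ℕ}
    (h : s ≤ t) : krylov A b s ≤ krylov A b t :=
  Submodule.span_mono (Set.image_mono (Set.Iio_subset_Iio h))

theorem krylov_le_full {d : ℕ} (A : Matrix (Fin d) (Fin d) ℝ) (b : Fin d → ℝ) (s : ℕ) :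
    krylov A b s ≤ fullKrylov A b :=
  Submodule.span_mono (Set.image_subset_range _ _)

theorem mem_krylov_of_lt {d : ℕ} (A : Matrix (Fin d) (Fin d) ℝ) (b : Fin d → ℝ) {k s : ℕ}
    (h : k < s) : (A ^ k).mulVec b ∈ krylov A b s :=
  Submodule.subset_span ⟨k, h, rfl⟩

theorem krylov_stab {d : ℕ} (A : Matrix (Fin d) (Fin d) ℝ) (b : Fin d → ℝ) (s : ℕ)
    (h : krylov A b s = krylov A b (s + 1)) : krylov A b s = fullKrylov A b := by
  apply le_antisymm (krylov_le_full A b s)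
  have step : ∀ v ∈ krylov A b s, A.mulVec v ∈ krylov A b s := by
    intro v hv
    have : krylov A b s ≤ (krylov A b s).comap A.mulVecLin := by
      conv_lhs => unfold krylov
      rw [Submodule.span_le]
      rintro _ ⟨k, hk, rfl⟩
      change A.mulVec ((A ^ k).mulVec b) ∈ krylov A b s
      rw [Matrix.mulVec_mulVec, ← pow_succ', h]
      exact mem_krylov_of_lt A b (Nat.succ_lt_succ hk)
    exact this hv
  unfold fullKrylov
  rw [Submodule.span_le]
  rintro _ ⟨k, rfl⟩
  change (A ^ k).mulVec b ∈ krylov A b s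
  induction k with
  | zero => rw [h]; exact mem_krylov_of_lt A b (Nat.succ_pos s)
  | succ k ih => rw [pow_succ', ← Matrix.mulVec_mulVec]; exact step _ ih

theorem krylov_dichotomy {d : ℕ} (A : Matrix (Fin d) (Fin d) ℝ) (b : Fin d → ℝ) (s : ℕ) :
    krylov A b s = fullKrylov A b ∨ s ≤ Module.finrank ℝ (krylov A b s) := by
  induction s with
  | zero => right; exact Nat.zero_le _
  | succ s ih =>
    by_cases hs : krylov A b s = fullKrylov A b
    · left
      exact le_antisymm (krylov_le_full A b _) (hs ▸ krylov_mono' A b (Nat.le_succ s))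
    · right
      have h1 := ih.resolve_left hs
      have h2 : krylov A b s < krylov A b (s + 1) :=
        lt_of_le_of_ne (krylov_mono' A b (Nat.le_succ s)) (fun h => hs (krylov_stab A b s h))
      have := Submodule.finrank_lt_finrank_of_lt h2
      omega

theorem krylov_finrank {d : ℕ} (A : Matrix (Fin d) (Fin d) ℝ) (b : Fin d → ℝ) :
    krylov A b (Module.finrank ℝ (fullKrylov A b)) = fullKrylov A b := by
  rcases krylov_dichotomy A b (Module.finrank ℝ (fullKrylov A b)) with h | h
  · exact h
  · exact Submodule.eq_of_le_of_finrank_le (krylov_le_full A b _) h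

theorem krylov_min {d : ℕ} (A : Matrix (Fin d) (Fin d) ℝ) (b : Fin d → ℝ) (s : ℕ) :
    krylov A b (min s (Module.finrank ℝ (fullKrylov A b))) = krylov A b s := by
  rcases le_total s (Module.finrank ℝ (fullKrylov A b)) with h | h
  · rw [min_eq_left h]
  · rw [min_eq_right h]
    apply le_antisymm (krylov_mono' A b h)
    rw [krylov_finrank]
    exact krylov_le_full A b s

/-- PLS solutions are invariant under orthogonal shifts: if `A` is symmetric positive
semidefinite, `b ∈ range(A)`, and `Ψ` satisfies `A Ψ = Ψ A = 0` and `Ψ b = 0`, then with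
`m := dim span{A^k b : k ∈ ℕ}`, for every `1 ≤ s ≤ d` a vector `ζ` minimizes
`ζ' ↦ ‖(A + Ψ) ζ' − b‖₂` over `K_s(A + Ψ, b)` iff it minimizes `ζ' ↦ ‖A ζ' − b‖₂` over
`K_{min(s,m)}(A, b)`. -/
theorem pls_shift_invariant {d : ℕ} (A Ψ : Matrix (Fin d) (Fin d) ℝ)
    (hA : A.PosSemidef) (b : Fin d → ℝ) (hb : b ∈ Set.range A.mulVec)
    (hΨ₁ : A * Ψ = 0) (hΨ₂ : Ψ * A = 0) (hΨb : Ψ.mulVec b = 0) :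
    ∀ s : ℕ, 1 ≤ s → s ≤ d → ∀ ζ : Fin d → ℝ,
      (ζ ∈ krylov (A + Ψ) b s ∧
        ∀ ζ' ∈ krylov (A + Ψ) b s,
          euclNorm ((A + Ψ).mulVec ζ - b) ≤ euclNorm ((A + Ψ).mulVec ζ' - b)) ↔
      (ζ ∈ krylov A b (min s (Module.finrank ℝ (fullKrylov A b))) ∧
        ∀ ζ' ∈ krylov A b (min s (Module.finrank ℝ (fullKrylov A b))),
          euclNorm (A.mulVec ζ - b) ≤ euclNorm (A.mulVec ζ' - b)) := by
  intro s _ _ ζ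
  have hz : ∀ k : ℕ, Ψ.mulVec ((A ^ k).mulVec b) = 0 := by
    intro k
    cases k with
    | zero => simpa using hΨb
    | succ k => rw [Matrix.mulVec_mulVec, pow_succ', ← mul_assoc, hΨ₂]; simp
  have hp : ∀ k : ℕ, ((A + Ψ) ^ k).mulVec b = (A ^ k).mulVec b := by
    intro k
    induction k with
    | zero => simp
    | succ k ih =>
      rw [pow_succ', ← Matrix.mulVec_mulVec, ih, Matrix.add_mulVec, hz, add_zero,
        Matrix.mulVec_mulVec, ← pow_succ']
  have hk : krylov (A + Ψ) b s = krylov A b s := by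
    unfold krylov
    simp only [hp]
  have hv : ∀ v ∈ krylov A b s, (A + Ψ).mulVec v = A.mulVec v := by
    intro v hv
    have : krylov A b s ≤ LinearMap.ker Ψ.mulVecLin := by
      unfold krylov
      rw [Submodule.span_le]
      rintro _ ⟨k, _, rfl⟩
      exact hz k
    have h0 : Ψ.mulVec v = 0 := this hv
    rw [Matrix.add_mulVec, h0, add_zero]
  rw [krylov_min, hk]
  refine and_congr_right fun hζ => forall₂_congr fun ζ' hζ' => ?_
  rw [hv ζ hζ, hv ζ' hζ']
end
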